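/- Let r ≥ 1. In the ring 𝔉 the identity Σ_{k=1}^{r} (x_k − S_{k−1})·(x_k − y_k) = 0 holds; equivalently, the element 𝛃₁ = Σ_{k=1}^r (x_k − S_{k−1})·x̂_k is a cycle in the Koszul complex K(𝔉; x_1 − y_1, …, x_r − y_r). -/

import Mathlib

noncomputable section
open MvPolynomial

/-- The `k`-th elementary symmetric function of a finite family of ring elements:
`e_k(v) = Σ_{S ⊆ ι, |S| = k} Π_{j ∈ S} v j`. -/
def esym {R : Type*} [CommRing R] {ι : Type*} [Fintype ι] [DecidableEq ι]
    (k : ℕ) (v : ι → R) : R :=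
  ∑ S ∈ Finset.univ.powersetCard k, ∏ j ∈ S, v j

/-- The polynomial ring `ℤ[x_1,…,x_r,y_1,…,y_r]`: `Sum.inl` indexes the `x`'s and
`Sum.inr` indexes the `y`'s. -/
abbrev FPoly (r : ℕ) := MvPolynomial (Fin r ⊕ Fin r) ℤ

/-- The relation `e_{j+1}(x) − e_{j+1}(y)` (so the degrees `1,…,r` occur as `j` runs
through `Fin r`). -/
def Frel (r : ℕ) (j : Fin r) : FPoly r :=
  esym ((j : ℕ) + 1) (fun i : Fin r => (X (Sum.inl i) : FPoly r)) -
    esym ((j : ℕ) + 1) (fun i : Fin r => (X (Sum.inr i) : FPoly r))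

/-- The ring `𝔉 = ℤ[x,y]/(e_1(x) − e_1(y), …, e_r(x) − e_r(y))`. -/
abbrev FRing (r : ℕ) := FPoly r ⧸ Ideal.span (Set.range (Frel r))

/-- `x_{j+1}` (zero-based index `j`) in `𝔉`; junk value `0` for `j ≥ r`. -/
def xF (r : ℕ) (j : ℕ) : FRing r :=
  if h : j < r then Ideal.Quotient.mk _ (X (Sum.inl ⟨j, h⟩)) else 0

/-- `y_{j+1}` (zero-based index `j`) in `𝔉`; junk value `0` for `j ≥ r`. -/
def yF (r : ℕ) (j : ℕ) : FRing r :=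
  if h : j < r then Ideal.Quotient.mk _ (X (Sum.inr ⟨j, h⟩)) else 0

/-- `S_m = Σ_{i=1}^m (y_i − x_i) ∈ 𝔉` for `0 ≤ m ≤ r − 1`, with the convention
`S_m = 0` for `m ≥ r` (in particular `S_r = 0`). -/
def SF (r : ℕ) (m : ℕ) : FRing r :=
  if m < r then ∑ j ∈ Finset.range m, (yF r j - xF r j) else 0

theorem map_esym {R S ι : Type*} [CommRing R] [CommRing S] [Fintype ι] [DecidableEq ι]
    (φ : R →+* S) (k : ℕ) (v : ι → R) : φ (esym k v) = esym k (fun i => φ (v i)) := by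
  simp only [esym, map_sum, map_prod]

theorem esym_eq_sum_powersetCard_range {R : Type*} [CommRing R] (r k : ℕ) (f : ℕ → R) :
    esym k (fun i : Fin r => f i) =
      ∑ S ∈ (Finset.range r).powersetCard k, ∏ j ∈ S, f j := by
  have h : Finset.range r = Finset.univ.map (Fin.valEmbedding (n := r)) := by
    ext; simp
  rw [h, Finset.powersetCard_map, Finset.sum_map, esym]
  simp [Finset.mapEmbedding_apply]

theorem esym_one_range {R : Type*} [CommRing R] (r : ℕ) (f : ℕ → R) :
    esym 1 (fun i : Fin r => f i) = ∑ k ∈ Finset.range r, f k := by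
  rw [esym_eq_sum_powersetCard_range, Finset.powersetCard_one, Finset.sum_map]
  simp

theorem esym_two_range {R : Type*} [CommRing R] (r : ℕ) (f : ℕ → R) :
    esym 2 (fun i : Fin r => f i) =
      ∑ k ∈ Finset.range r, f k * ∑ j ∈ Finset.range k, f j := by
  rw [esym_eq_sum_powersetCard_range]
  induction r with
  | zero => rfl
  | succ n ih =>
    have hn : n ∉ Finset.range n := Finset.notMem_range_self
    rw [Finset.sum_range_succ, ← ih, Finset.range_add_one, Finset.powersetCard_succ_insert hn,
      Finset.sum_union, Finset.sum_image, Finset.powersetCard_one, Finset.sum_map, Finset.mul_sum]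
    · congr 1
      refine Finset.sum_congr rfl fun j hj => ?_
      exact Finset.prod_pair (Finset.mem_range.mp hj).ne'
    · intro S hS T hT hST
      rw [Finset.mem_coe, Finset.mem_powersetCard] at hS hT
      rw [← Finset.erase_insert fun h => hn (hS.1 h), hST,
        Finset.erase_insert fun h => hn (hT.1 h)]
    · rw [Finset.disjoint_left]
      intro S hS hS'
      obtain ⟨T, -, rfl⟩ := Finset.mem_image.mp hS'
      exact hn ((Finset.mem_powersetCard.mp hS).1 (Finset.mem_insert_self n T))

/-- Telescoping form of `Σ (x_k − S_{k−1})(x_k − y_k) = e₁(x)(e₁(x) − e₁(y)) − (e₂(x) − e₂(y))`,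
valid in any commutative ring. -/
theorem sum_sub_sum_mul_sub {R : Type*} [CommRing R] (r : ℕ) (x y : ℕ → R) :
    ∑ k ∈ Finset.range r, (x k - ∑ j ∈ Finset.range k, (y j - x j)) * (x k - y k) =
      (∑ k ∈ Finset.range r, x k) * (∑ k ∈ Finset.range r, x k - ∑ k ∈ Finset.range r, y k) -
        (∑ k ∈ Finset.range r, x k * ∑ j ∈ Finset.range k, x j -
          ∑ k ∈ Finset.range r, y k * ∑ j ∈ Finset.range k, y j) := by
  induction r with
  | zero => simp
  | succ n ih =>
    simp only [Finset.sum_range_succ, ih]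
    rw [Finset.sum_sub_distrib]
    ring

theorem esym_xF_eq_esym_yF (r k : ℕ) (hk : k < r) :
    esym (k + 1) (fun i : Fin r => xF r i) = esym (k + 1) (fun i : Fin r => yF r i) := by
  have h : Ideal.Quotient.mk (Ideal.span (Set.range (Frel r))) (Frel r ⟨k, hk⟩) = 0 :=
    Ideal.Quotient.eq_zero_iff_mem.mpr (Ideal.subset_span ⟨_, rfl⟩)
  rw [Frel, map_sub, map_esym, map_esym, sub_eq_zero] at h
  simpa [xF, yF] using h

/-- For `r ≥ 1`, in the ring `𝔉` the identity
`Σ_{k=1}^{r} (x_k − S_{k−1})·(x_k − y_k) = 0` holds (zero-based: the summation index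
below is `k − 1`, so `x_k = xF r k`, `S_{k−1} = SF r k`); equivalently, the element
`𝛃₁ = Σ_{k=1}^r (x_k − S_{k−1})·x̂_k` is a cycle in the Koszul complex
`K(𝔉; x_1 − y_1, …, x_r − y_r)` (the differential of a degree-1 element
`Σ c_k x̂_k` is exactly `Σ c_k·(x_k − y_k)`). -/
theorem stmt6 (r : ℕ) (hr : 1 ≤ r) :
    ∑ k ∈ Finset.range r, (xF r k - SF r k) * (xF r k - yF r k) = 0 := by
  have hS : ∀ k ∈ Finset.range r, (xF r k - SF r k) * (xF r k - yF r k) =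
      (xF r k - ∑ j ∈ Finset.range k, (yF r j - xF r j)) * (xF r k - yF r k) := fun k hk => by
    rw [SF, if_pos (Finset.mem_range.mp hk)]
  have h₁ := esym_xF_eq_esym_yF r 0 hr
  rw [zero_add, esym_one_range, esym_one_range] at h₁
  have h₂ : esym 2 (fun i : Fin r => xF r i) = esym 2 (fun i : Fin r => yF r i) := by
    rcases hr.eq_or_lt with rfl | hr'
    · rw [esym_two_range, esym_two_range]; simp
    · exact esym_xF_eq_esym_yF r 1 hr'
  rw [esym_two_range, esym_two_range] at h₂
  rw [Finset.sum_congr rfl hS, sum_sub_sum_mul_sub, h₁, h₂, sub_self, sub_self, mul_zero,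
    sub_zero]
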